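/- arXiv:math/0607196 — 2 statements merged into one kernel-verified Lean document; each statement's English description precedes it below -/
import Mathlib

section
/- For any positive integers d and l ≥ 2, almost surely, as x → ∞, Π_{X,X+d,…,X+(l−1)d}(x) ~ x/(log x)^l; that is, for ℙ-almost every realization α of the Hawkins random sieve, the number of arithmetic progressions m, m+d, …, m+(l−1)d entirely contained in α with m ≤ x is asymptotic to x/(log x)^l. -/
open MeasureTheory Filter Finset Asymptotics
open scoped Classical

/-- `y_m(α) = ∏_{j ∈ α, j < m} (1 - 1/j)` (empty product = 1). -/
noncomputable def hawkinsY (A : Set ℕ) (m : ℕ) : ℝ :=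
  ∏ j ∈ Finset.range m, if j ∈ A then 1 - 1 / (j : ℝ) else 1

/-- The σ-algebra generated by the events `{j ∈ α}` for `2 ≤ j < m`. -/
def sieveSigma {Ω : Type*} (α : Ω → Set ℕ) (m : ℕ) : MeasurableSpace Ω :=
  MeasurableSpace.generateFrom {s | ∃ j : ℕ, 2 ≤ j ∧ j < m ∧ s = {ω | j ∈ α ω}}

/-- Wunderlich's model of the Hawkins random sieve: a probability space `(Ω, μ)` with a
random subset `α` of `{2,3,4,…}` such that `μ(2 ∈ α) = 1` and, for every `m ≥ 2`, the
conditional probability of `{m ∈ α}` given the σ-algebra generated by the events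
`{j ∈ α}`, `2 ≤ j < m`, equals `y_m(α)`. -/
structure IsHawkinsSieve {Ω : Type*} [MeasurableSpace Ω] (μ : Measure Ω)
    (α : Ω → Set ℕ) : Prop where
  isProb : IsProbabilityMeasure μ
  meas : ∀ n : ℕ, MeasurableSet {ω | n ∈ α ω}
  mem_ge_two : ∀ ω, ∀ n ∈ α ω, 2 ≤ n
  two_mem : μ {ω | 2 ∈ α ω} = 1
  condExp_mem : ∀ m : ℕ, 2 ≤ m →
    μ[Set.indicator {ω | m ∈ α ω} (fun _ => (1 : ℝ)) | sieveSigma α m]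
      =ᵐ[μ] fun ω => hawkinsY (α ω) m

/-- `M_k = 1 + ∑_{j=1}^{k-2} 1/j` (so `M_2 = 1`). -/
noncomputable def Mharm (k : ℕ) : ℝ := 1 + ∑ j ∈ Finset.Icc 1 (k - 2), 1 / (j : ℝ)

/-- The number of `m ≤ x` such that the arithmetic progression
`m, m + d, …, m + (l-1)d` is entirely contained in `α`. -/
noncomputable def piAP (A : Set ℕ) (d l x : ℕ) : ℕ :=
  ((Finset.range (x + 1)).filter fun m => ∀ j : ℕ, j < l → m + j * d ∈ A).card

/-- Sums of square-integrable martingale differences converge almost surely as soon as their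
second moments are summable. -/
theorem ae_exists_tendsto_sum_of_condExp_eq_zero {Ω : Type*} {m0 : MeasurableSpace Ω}
    {μ : Measure Ω} [IsProbabilityMeasure μ] (ℱ : Filtration ℕ m0) {Z : ℕ → Ω → ℝ}
    (hmeas : ∀ n, StronglyMeasurable[ℱ (n + 1)] (Z n)) (hL2 : ∀ n, MemLp (Z n) 2 μ)
    (hzero : ∀ n, μ[Z n | ℱ n] =ᵐ[μ] 0) (hsum : Summable fun n => ∫ ω, Z n ω ^ 2 ∂μ) :
    ∀ᵐ ω ∂μ, ∃ c, Tendsto (fun N => ∑ n ∈ Finset.range N, Z n ω) atTop (nhds c) := by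
  set S : ℕ → Ω → ℝ := fun N ω => ∑ n ∈ Finset.range N, Z n ω with hS
  have hSsucc : ∀ N, S (N + 1) = S N + Z N := fun N => by
    ext ω; simp [hS, Finset.sum_range_succ]
  have hSL2 : ∀ N, MemLp (S N) 2 μ := fun N => memLp_finsetSum _ fun n _ => hL2 n
  have hSmeas : ∀ N, StronglyMeasurable[ℱ N] (S N) := fun N =>
    Finset.stronglyMeasurable_fun_sum _ fun n hn =>
      (hmeas n).mono (ℱ.mono (Nat.succ_le_of_lt (Finset.mem_range.1 hn)))
  have hcross : ∀ N, ∫ ω, S N ω * Z N ω ∂μ = 0 := fun N => by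
    have hintegrable : Integrable (S N * Z N) μ := (hSL2 N).integrable_mul (hL2 N)
    have hce : μ[S N * Z N | ℱ N] =ᵐ[μ] 0 := by
      filter_upwards [condExp_mul_of_stronglyMeasurable_left (hSmeas N) hintegrable
        ((hL2 N).integrable one_le_two), hzero N] with ω h1 h2
      simp [h1, h2]
    have := integral_condExp (μ := μ) (f := S N * Z N) (ℱ.le N)
    rw [integral_congr_ae hce] at this
    simpa using this.symm
  have hsq : ∀ N, ∫ ω, S N ω ^ 2 ∂μ = ∑ n ∈ Finset.range N, ∫ ω, Z n ω ^ 2 ∂μ := by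
    intro N
    induction N with
    | zero => simp [hS]
    | succ N ih =>
      have hintegrable : Integrable (fun ω => S N ω * Z N ω) μ := (hSL2 N).integrable_mul (hL2 N)
      rw [Finset.sum_range_succ, ← ih, hSsucc]
      have : ∀ ω, (S N + Z N) ω ^ 2 = S N ω ^ 2 + 2 * (S N ω * Z N ω) + Z N ω ^ 2 :=
        fun ω => by simp only [Pi.add_apply]; ring
      simp_rw [this]
      have hintegrable_sum : Integrable (fun ω => S N ω ^ 2 + 2 * (S N ω * Z N ω)) μ :=
        (hSL2 N).integrable_sq.add (hintegrable.const_mul 2)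
      rw [integral_add hintegrable_sum (hL2 N).integrable_sq,
        integral_add (hSL2 N).integrable_sq (hintegrable.const_mul 2), integral_const_mul, hcross]
      ring
  have hmart : Martingale S ℱ μ :=
    martingale_of_condExp_sub_eq_zero_nat hSmeas (fun N => (hSL2 N).integrable one_le_two)
      fun N => by rw [hSsucc, add_sub_cancel_left]; exact hzero N
  refine hmart.submartingale.exists_ae_tendsto_of_bdd
    (R := (1 + ∑' n, ∫ ω, Z n ω ^ 2 ∂μ).toNNReal) fun N => ?_
  have hintegrable := (hSL2 N).integrable one_le_two
  rw [eLpNorm_one_eq_lintegral_enorm, ← ofReal_integral_norm_eq_lintegral_enorm hintegrable]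
  refine ENNReal.ofReal_le_ofReal ?_
  calc ∫ ω, ‖S N ω‖ ∂μ ≤ ∫ ω, (1 + S N ω ^ 2) ∂μ := by
        refine integral_mono hintegrable.norm ((integrable_const 1).add (hSL2 N).integrable_sq)
          fun ω => ?_
        simp only [Real.norm_eq_abs]
        nlinarith [sq_abs (S N ω), sq_nonneg (|S N ω| - 1)]
    _ = 1 + ∑ n ∈ Finset.range N, ∫ ω, Z n ω ^ 2 ∂μ := by
        rw [integral_add (integrable_const 1) (hSL2 N).integrable_sq, hsq]; simp
    _ ≤ _ := by
        gcongr
        exact hsum.sum_le_tsum _ fun n _ => integral_nonneg fun ω => sq_nonneg _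

/-- The indicator of a set of natural numbers, with real values. -/
noncomputable def sieveInd (A : Set ℕ) (n : ℕ) : ℝ := if n ∈ A then 1 else 0

theorem sieveInd_nonneg (A : Set ℕ) (n : ℕ) : 0 ≤ sieveInd A n := by
  unfold sieveInd; split_ifs <;> norm_num

theorem sieveInd_le_one (A : Set ℕ) (n : ℕ) : sieveInd A n ≤ 1 := by
  unfold sieveInd; split_ifs <;> norm_num

theorem sieveInd_sq (A : Set ℕ) (n : ℕ) : sieveInd A n ^ 2 = sieveInd A n := by
  unfold sieveInd; split_ifs <;> norm_num

theorem hawkinsY_succ (A : Set ℕ) (m : ℕ) :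
    hawkinsY A (m + 1) = hawkinsY A m * (1 - sieveInd A m / m) := by
  rw [hawkinsY, Finset.prod_range_succ, ← hawkinsY, sieveInd]
  split_ifs <;> simp

section Deterministic

variable {A : Set ℕ}

theorem one_half_pow_le_hawkinsY (hA : ∀ n ∈ A, 2 ≤ n) (m : ℕ) :
    (1 / 2 : ℝ) ^ m ≤ hawkinsY A m := by
  have := Finset.prod_le_prod (s := Finset.range m) (f := fun _ => (1 / 2 : ℝ))
    (g := fun j => if j ∈ A then 1 - 1 / (j : ℝ) else 1) (fun _ _ => by norm_num) fun j _ => by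
      split_ifs with hj
      · have h2 : (2 : ℝ) ≤ j := by exact_mod_cast hA j hj
        have : 1 / (j : ℝ) ≤ 1 / 2 := one_div_le_one_div_of_le (by norm_num) h2
        linarith
      · norm_num
  simpa [hawkinsY] using this

theorem hawkinsY_pos (hA : ∀ n ∈ A, 2 ≤ n) (m : ℕ) : 0 < hawkinsY A m :=
  lt_of_lt_of_le (by positivity) (one_half_pow_le_hawkinsY hA m)

theorem hawkinsY_antitone (hA : ∀ n ∈ A, 2 ≤ n) : Antitone (hawkinsY A) :=
  antitone_nat_of_succ_le fun m => by
    rw [hawkinsY_succ]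
    refine mul_le_of_le_one_right (hawkinsY_pos hA m).le ?_
    have := div_nonneg (sieveInd_nonneg A m) (Nat.cast_nonneg (α := ℝ) m)
    linarith

theorem hawkinsY_le_one (hA : ∀ n ∈ A, 2 ≤ n) (m : ℕ) : hawkinsY A m ≤ 1 := by
  simpa [hawkinsY] using hawkinsY_antitone hA (Nat.zero_le m)

theorem hawkinsY_two (hA : ∀ n ∈ A, 2 ≤ n) : hawkinsY A 2 = 1 := by
  have h0 : 0 ∉ A := fun h => by simpa using hA 0 h
  have h1 : 1 ∉ A := fun h => by simpa using hA 1 h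
  simp [hawkinsY, Finset.prod_range_succ, h0, h1]

theorem inv_hawkinsY_succ (hA : ∀ n ∈ A, 2 ≤ n) (n : ℕ) :
    (hawkinsY A (n + 3))⁻¹ = (hawkinsY A (n + 2))⁻¹
      + ((n + 1 : ℝ) * hawkinsY A (n + 2))⁻¹ * sieveInd A (n + 2) := by
  have hy := (hawkinsY_pos hA (n + 2)).ne'
  rw [hawkinsY_succ A (n + 2)]
  have h1 : (n : ℝ) + 1 ≠ 0 := by positivity
  have h2 : (n : ℝ) + 2 ≠ 0 := by positivity
  unfold sieveInd
  split_ifs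
  · have : (1 : ℝ) - 1 / ((n + 2 : ℕ) : ℝ) = (n + 1) / (n + 2) := by
      push_cast; field_simp; ring
    rw [this]; field_simp; ring
  · simp

theorem abs_hawkinsY_add_sub_le (hA : ∀ n ∈ A, 2 ≤ n) {m : ℕ} (hm : 0 < m) (s : ℕ) :
    |hawkinsY A (m + s) - hawkinsY A m| ≤ s / m := by
  rw [abs_sub_comm, abs_of_nonneg (sub_nonneg.2 (hawkinsY_antitone hA (Nat.le_add_right m s)))]
  induction s with
  | zero => simp
  | succ s ih =>
    rw [← add_assoc, hawkinsY_succ]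
    have h1 : hawkinsY A (m + s) * (sieveInd A (m + s) / ((m + s : ℕ) : ℝ)) ≤ 1 * (1 / m) := by
      refine mul_le_mul (hawkinsY_le_one hA _) ?_
        (div_nonneg (sieveInd_nonneg _ _) (Nat.cast_nonneg _)) zero_le_one
      refine div_le_div₀ zero_le_one (sieveInd_le_one _ _) (by exact_mod_cast hm) ?_
      exact_mod_cast Nat.le_add_right m s
    have h2 : ((s + 1 : ℕ) : ℝ) / m = s / m + 1 / m := by push_cast; ring
    rw [h2]
    linarith

end Deterministic

theorem one_add_harmonic_le (n : ℕ) :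
    1 + (harmonic n : ℝ) ≤ 4 * ((n : ℝ) + 1) ^ (1 / 2 : ℝ) := by
  have h1 := harmonic_le_one_add_log n
  have h2 : Real.log n ≤ Real.log (n + 1) := by
    rcases n.eq_zero_or_pos with rfl | hn
    · simp
    · exact Real.log_le_log (by exact_mod_cast hn) (by linarith)
  have h3 := Real.log_le_rpow_div (x := (n : ℝ) + 1) (ε := 1 / 2) (by positivity) (by norm_num)
  have h4 : (1 : ℝ) ≤ ((n : ℝ) + 1) ^ (1 / 2 : ℝ) :=
    Real.one_le_rpow (by linarith [Nat.cast_nonneg (α := ℝ) n]) (by norm_num)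
  linarith

theorem summable_nat_add_one_rpow_neg_three_halves :
    Summable fun n : ℕ => ((n : ℝ) + 1) ^ (-(3 / 2) : ℝ) := by
  have := (summable_nat_add_iff 1).2
    (Real.summable_nat_rpow (p := (-(3 / 2) : ℝ)).2 (by norm_num))
  simpa using this

section Sieve

variable {Ω : Type*} {m0 : MeasurableSpace Ω} {μ : Measure Ω} {α : Ω → Set ℕ}

theorem sieveSigma_mono (α : Ω → Set ℕ) : Monotone (sieveSigma α) := fun _ _ h =>
  MeasurableSpace.generateFrom_mono fun _ ⟨j, h2, hj, hs⟩ => ⟨j, h2, hj.trans_le h, hs⟩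

namespace IsHawkinsSieve

theorem sieveSigma_le (h : IsHawkinsSieve μ α) (m : ℕ) : sieveSigma α m ≤ m0 :=
  MeasurableSpace.generateFrom_le fun _ ⟨j, _, _, hs⟩ => hs ▸ h.meas j

/-- The filtration of the sieve, shifted by `s`. -/
def filtration (h : IsHawkinsSieve μ α) (s : ℕ) : Filtration ℕ m0 where
  seq n := sieveSigma α (n + s)
  mono' _ _ hmn := sieveSigma_mono α (Nat.add_le_add_right hmn s)
  le' n := h.sieveSigma_le (n + s)

theorem stronglyMeasurable_sieveInd (h : IsHawkinsSieve μ α) {j m : ℕ} (hj : j < m) :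
    StronglyMeasurable[sieveSigma α m] fun ω => sieveInd (α ω) j := by
  have hset : MeasurableSet[sieveSigma α m] {ω | j ∈ α ω} := by
    by_cases h2 : 2 ≤ j
    · exact MeasurableSpace.measurableSet_generateFrom ⟨j, h2, hj, rfl⟩
    · have : {ω | j ∈ α ω} = ∅ := Set.eq_empty_of_forall_notMem fun ω hω =>
        h2 (h.mem_ge_two ω j hω)
      rw [this]
      exact @MeasurableSet.empty _ (sieveSigma α m)
  exact (Measurable.ite hset measurable_const measurable_const).stronglyMeasurable

theorem stronglyMeasurable_hawkinsY (h : IsHawkinsSieve μ α) (m : ℕ) :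
    StronglyMeasurable[sieveSigma α m] fun ω => hawkinsY (α ω) m := by
  have : ∀ ω, hawkinsY (α ω) m = ∏ j ∈ Finset.range m, (1 - sieveInd (α ω) j / j) := fun ω =>
    Finset.prod_congr rfl fun j _ => by unfold sieveInd; split_ifs <;> simp
  simp_rw [this]
  exact Finset.stronglyMeasurable_fun_prod _ fun j hj =>
    stronglyMeasurable_const.sub
      ((h.stronglyMeasurable_sieveInd (Finset.mem_range.1 hj)).div stronglyMeasurable_const)

theorem stronglyMeasurable_sieveInd_sub (h : IsHawkinsSieve μ α) (m : ℕ) :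
    StronglyMeasurable[sieveSigma α (m + 1)]
      fun ω => sieveInd (α ω) m - hawkinsY (α ω) m :=
  (h.stronglyMeasurable_sieveInd m.lt_succ_self).sub
    ((h.stronglyMeasurable_hawkinsY m).mono (sieveSigma_mono α m.le_succ))

theorem abs_sieveInd_sub_le (h : IsHawkinsSieve μ α) (m : ℕ) (ω : Ω) :
    |sieveInd (α ω) m - hawkinsY (α ω) m| ≤ 1 := by
  have h1 := (hawkinsY_pos (h.mem_ge_two ω) m).le
  have h2 := hawkinsY_le_one (h.mem_ge_two ω) m
  have h3 := sieveInd_nonneg (α ω) m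
  have h4 := sieveInd_le_one (α ω) m
  rw [abs_le]; constructor <;> linarith

theorem integrable_of_abs_le (h : IsHawkinsSieve μ α) {m : ℕ} {f : Ω → ℝ} {C : ℝ}
    (hf : StronglyMeasurable[sieveSigma α m] f) (hC : ∀ ω, |f ω| ≤ C) : Integrable f μ :=
  have := h.isProb
  .of_bound (hf.mono (h.sieveSigma_le m)).aestronglyMeasurable C (ae_of_all _ hC)

theorem condExp_mul_sieveInd_sub (h : IsHawkinsSieve μ α) {m : ℕ} (hm : 2 ≤ m) {f : Ω → ℝ}
    {C : ℝ} (hf : StronglyMeasurable[sieveSigma α m] f) (hC : ∀ ω, |f ω| ≤ C) :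
    μ[fun ω => f ω * (sieveInd (α ω) m - hawkinsY (α ω) m) | sieveSigma α m] =ᵐ[μ] 0 := by
  have := h.isProb
  have hI : Integrable (fun ω => sieveInd (α ω) m) μ :=
    h.integrable_of_abs_le (h.stronglyMeasurable_sieveInd m.lt_succ_self) fun ω => by
      rw [abs_of_nonneg (sieveInd_nonneg _ _)]; exact sieveInd_le_one _ _
  have hY : Integrable (fun ω => hawkinsY (α ω) m) μ :=
    h.integrable_of_abs_le (h.stronglyMeasurable_hawkinsY m) fun ω => by
      rw [abs_of_pos (hawkinsY_pos (h.mem_ge_two ω) m)]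
      exact hawkinsY_le_one (h.mem_ge_two ω) m
  have hce : μ[fun ω => sieveInd (α ω) m | sieveSigma α m]
      =ᵐ[μ] fun ω => hawkinsY (α ω) m := by
    have : (fun ω => sieveInd (α ω) m) =
        Set.indicator {ω | m ∈ α ω} (fun _ => (1 : ℝ)) := by
      ext ω; simp [sieveInd, Set.indicator_apply]
    rw [this]
    exact h.condExp_mem m hm
  have hYce := condExp_of_stronglyMeasurable (h.sieveSigma_le m)
    (h.stronglyMeasurable_hawkinsY m) hY
  have hpull := condExp_stronglyMeasurable_mul_of_bound (h.sieveSigma_le m) hf (hI.sub hY) C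
    (ae_of_all _ hC)
  filter_upwards [hpull, condExp_sub hI hY (sieveSigma α m), hce] with ω h1 h2 h3
  refine h1.trans ?_
  have h4 : (μ[(fun ω => sieveInd (α ω) m) - (fun ω => hawkinsY (α ω) m) | sieveSigma α m]) ω
      = 0 := by
    rw [h2, Pi.sub_apply, h3, hYce, sub_self]
  rw [Pi.mul_apply, h4, mul_zero, Pi.zero_apply]

theorem integral_mul_sieveInd (h : IsHawkinsSieve μ α) {m : ℕ} (hm : 2 ≤ m) {f : Ω → ℝ}
    {C : ℝ} (hf : StronglyMeasurable[sieveSigma α m] f) (hC : ∀ ω, |f ω| ≤ C) :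
    ∫ ω, f ω * sieveInd (α ω) m ∂μ = ∫ ω, f ω * hawkinsY (α ω) m ∂μ := by
  have := h.isProb
  have hf' := hf.mono (sieveSigma_mono α m.le_succ)
  have hI : Integrable (fun ω => f ω * sieveInd (α ω) m) μ :=
    h.integrable_of_abs_le (C := C) (hf'.mul (h.stronglyMeasurable_sieveInd m.lt_succ_self))
      fun ω => by
        rw [abs_mul, abs_of_nonneg (sieveInd_nonneg _ _)]
        exact (mul_le_of_le_one_right (abs_nonneg _) (sieveInd_le_one _ _)).trans (hC ω)
  have hY : Integrable (fun ω => f ω * hawkinsY (α ω) m) μ :=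
    h.integrable_of_abs_le (C := C) (hf.mul (h.stronglyMeasurable_hawkinsY m)) fun ω => by
      rw [abs_mul, abs_of_pos (hawkinsY_pos (h.mem_ge_two ω) m)]
      exact (mul_le_of_le_one_right (abs_nonneg _)
        (hawkinsY_le_one (h.mem_ge_two ω) m)).trans (hC ω)
  have := integral_condExp (μ := μ)
    (f := fun ω => f ω * (sieveInd (α ω) m - hawkinsY (α ω) m)) (h.sieveSigma_le m)
  rw [integral_congr_ae (h.condExp_mul_sieveInd_sub hm hf hC)] at this
  simp_rw [mul_sub] at this
  rw [integral_sub hI hY] at this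
  simp only [Pi.zero_apply, integral_zero] at this
  linarith

theorem integral_sq_mul_sieveInd_sub_le (h : IsHawkinsSieve μ α) {m : ℕ} (hm : 2 ≤ m)
    {g : Ω → ℝ} {C : ℝ} (hg : StronglyMeasurable[sieveSigma α m] g) (hC : ∀ ω, |g ω| ≤ C) :
    ∫ ω, (g ω * (sieveInd (α ω) m - hawkinsY (α ω) m)) ^ 2 ∂μ
      ≤ ∫ ω, g ω ^ 2 * hawkinsY (α ω) m ∂μ := by
  have hY := h.stronglyMeasurable_hawkinsY m
  have hpos := fun ω => hawkinsY_pos (h.mem_ge_two ω) m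
  have hle := fun ω => hawkinsY_le_one (h.mem_ge_two ω) m
  have hg2 : ∀ ω, g ω ^ 2 ≤ C ^ 2 := fun ω => sq_le_sq' (abs_le.1 (hC ω)).1 (abs_le.1 (hC ω)).2
  set f : Ω → ℝ := fun ω => g ω ^ 2 * (1 - 2 * hawkinsY (α ω) m) with hf
  have hfm : StronglyMeasurable[sieveSigma α m] f :=
    (hg.pow 2).mul (stronglyMeasurable_const.sub (stronglyMeasurable_const.mul hY))
  have hfC : ∀ ω, |f ω| ≤ C ^ 2 := fun ω => by
    rw [hf, abs_mul, abs_of_nonneg (sq_nonneg _)]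
    refine (mul_le_of_le_one_right (sq_nonneg _) ?_).trans (hg2 ω)
    have := hpos ω
    have := hle ω
    rw [abs_le]; constructor <;> linarith
  have hfI : Integrable (fun ω => f ω * sieveInd (α ω) m) μ :=
    h.integrable_of_abs_le (C := C ^ 2) ((hfm.mono (sieveSigma_mono α m.le_succ)).mul
      (h.stronglyMeasurable_sieveInd m.lt_succ_self)) fun ω => by
        rw [abs_mul, abs_of_nonneg (sieveInd_nonneg _ _)]
        exact (mul_le_of_le_one_right (abs_nonneg _) (sieveInd_le_one _ _)).trans (hfC ω)
  have hfY : Integrable (fun ω => f ω * hawkinsY (α ω) m) μ :=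
    h.integrable_of_abs_le (C := C ^ 2) (hfm.mul hY) fun ω => by
      rw [abs_mul, abs_of_pos (hpos ω)]
      exact (mul_le_of_le_one_right (abs_nonneg _) (hle ω)).trans (hfC ω)
  have hgY : Integrable (fun ω => g ω ^ 2 * hawkinsY (α ω) m) μ :=
    h.integrable_of_abs_le (C := C ^ 2) ((hg.pow 2).mul hY) fun ω => by
      rw [abs_mul, abs_of_pos (hpos ω), abs_of_nonneg (sq_nonneg _)]
      exact (mul_le_of_le_one_right (sq_nonneg _) (hle ω)).trans (hg2 ω)
  have hgY2 : Integrable (fun ω => g ω ^ 2 * hawkinsY (α ω) m ^ 2) μ :=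
    h.integrable_of_abs_le (C := C ^ 2) ((hg.pow 2).mul (hY.pow 2)) fun ω => by
      rw [abs_mul, abs_of_nonneg (sq_nonneg (hawkinsY _ _)), abs_of_nonneg (sq_nonneg (g ω))]
      exact (mul_le_of_le_one_right (sq_nonneg _)
        (pow_le_one₀ (hpos ω).le (hle ω))).trans (hg2 ω)
  have hexp : ∀ ω, (g ω * (sieveInd (α ω) m - hawkinsY (α ω) m)) ^ 2
      = f ω * sieveInd (α ω) m + g ω ^ 2 * hawkinsY (α ω) m ^ 2 := fun ω => by
    have := sieveInd_sq (α ω) m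
    simp only [hf]
    linear_combination g ω ^ 2 * this
  simp_rw [hexp]
  rw [integral_add hfI hgY2, h.integral_mul_sieveInd hm hfm hfC, ← integral_add hfY hgY2]
  refine integral_mono (hfY.add hgY2) hgY fun ω => ?_
  simp only [hf]
  nlinarith [mul_nonneg (sq_nonneg (g ω)) (sq_nonneg (hawkinsY (α ω) m))]

theorem ae_exists_tendsto_sum_mul_sieveInd_sub (h : IsHawkinsSieve μ α) {s : ℕ} (hs : 2 ≤ s)
    {g : ℕ → Ω → ℝ} (hg : ∀ n, StronglyMeasurable[sieveSigma α (n + s)] (g n))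
    (hC : ∀ n, ∃ C, ∀ ω, |g n ω| ≤ C)
    (hsum : Summable fun n => ∫ ω, g n ω ^ 2 * hawkinsY (α ω) (n + s) ∂μ) :
    ∀ᵐ ω ∂μ, ∃ c, Tendsto (fun N => ∑ n ∈ Finset.range N,
      g n ω * (sieveInd (α ω) (n + s) - hawkinsY (α ω) (n + s))) atTop (nhds c) := by
  have := h.isProb
  choose C hC using hC
  have hm : ∀ n, StronglyMeasurable[sieveSigma α (n + s + 1)]
      fun ω => g n ω * (sieveInd (α ω) (n + s) - hawkinsY (α ω) (n + s)) := fun n =>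
    ((hg n).mono (sieveSigma_mono α (n + s).le_succ)).mul (h.stronglyMeasurable_sieveInd_sub _)
  refine ae_exists_tendsto_sum_of_condExp_eq_zero (h.filtration s)
    (Z := fun n ω => g n ω * (sieveInd (α ω) (n + s) - hawkinsY (α ω) (n + s)))
    (fun n => ?_) (fun n => ?_) (fun n => ?_) ?_
  · have := hm n
    rwa [add_right_comm] at this
  · refine MemLp.of_bound ((hm n).mono (h.sieveSigma_le _)).aestronglyMeasurable (C n)
      (ae_of_all _ fun ω => ?_)
    rw [Real.norm_eq_abs, abs_mul]
    exact (mul_le_of_le_one_right (abs_nonneg _) (h.abs_sieveInd_sub_le _ ω)).trans (hC n ω)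
  · exact h.condExp_mul_sieveInd_sub (by omega) (hg n) (hC n)
  · exact hsum.of_nonneg_of_le (fun n => integral_nonneg fun ω => sq_nonneg _) fun n =>
      h.integral_sq_mul_sieveInd_sub_le (by omega) (hg n) (hC n)

theorem inv_hawkinsY_le (h : IsHawkinsSieve μ α) (m : ℕ) (ω : Ω) :
    |(hawkinsY (α ω) m)⁻¹| ≤ 2 ^ m := by
  rw [abs_of_pos (inv_pos.2 (hawkinsY_pos (h.mem_ge_two ω) m))]
  refine inv_le_of_inv_le₀ (by positivity) ?_
  simpa using one_half_pow_le_hawkinsY (h.mem_ge_two ω) m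

theorem stronglyMeasurable_inv_hawkinsY (h : IsHawkinsSieve μ α) (m : ℕ) :
    StronglyMeasurable[sieveSigma α m] fun ω => (hawkinsY (α ω) m)⁻¹ :=
  (h.stronglyMeasurable_hawkinsY m).inv₀

theorem abs_inv_mul_hawkinsY_le (h : IsHawkinsSieve μ α) (n : ℕ) (ω : Ω) :
    |((n + 1 : ℝ) * hawkinsY (α ω) (n + 2))⁻¹| ≤ 2 ^ (n + 2) := by
  rw [mul_inv, abs_mul]
  refine (mul_le_of_le_one_left (abs_nonneg _) ?_).trans (h.inv_hawkinsY_le _ ω)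
  rw [abs_of_pos (by positivity)]
  exact inv_le_one_of_one_le₀ (by linarith [Nat.cast_nonneg (α := ℝ) n])

theorem stronglyMeasurable_inv_mul_hawkinsY (h : IsHawkinsSieve μ α) (n : ℕ) :
    StronglyMeasurable[sieveSigma α (n + 2)]
      fun ω => ((n + 1 : ℝ) * hawkinsY (α ω) (n + 2))⁻¹ := by
  simp_rw [mul_inv]
  exact stronglyMeasurable_const.mul (h.stronglyMeasurable_inv_hawkinsY _)

theorem integral_inv_hawkinsY (h : IsHawkinsSieve μ α) (n : ℕ) :
    ∫ ω, (hawkinsY (α ω) (n + 2))⁻¹ ∂μ = 1 + harmonic n := by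
  have := h.isProb
  induction n with
  | zero => simp [hawkinsY_two (h.mem_ge_two _)]
  | succ n ih =>
    have hm := h.stronglyMeasurable_inv_mul_hawkinsY n
    have hb := h.abs_inv_mul_hawkinsY_le n
    have hintegrable : Integrable (fun ω =>
        ((n + 1 : ℝ) * hawkinsY (α ω) (n + 2))⁻¹ * sieveInd (α ω) (n + 2)) μ :=
      h.integrable_of_abs_le (C := 2 ^ (n + 2)) ((hm.mono (sieveSigma_mono α (Nat.le_succ _))).mul
        (h.stronglyMeasurable_sieveInd (Nat.lt_succ_self _))) fun ω => by
          rw [abs_mul, abs_of_nonneg (sieveInd_nonneg _ _)]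
          exact (mul_le_of_le_one_right (abs_nonneg _) (sieveInd_le_one _ _)).trans (hb ω)
    have hcancel : ∀ ω, ((n + 1 : ℝ) * hawkinsY (α ω) (n + 2))⁻¹ * hawkinsY (α ω) (n + 2)
        = ((n : ℝ) + 1)⁻¹ := fun ω => by
      have := (hawkinsY_pos (h.mem_ge_two ω) (n + 2)).ne'
      field_simp
    simp_rw [show n + 1 + 2 = n + 3 by rfl, inv_hawkinsY_succ (h.mem_ge_two _)]
    rw [integral_add (h.integrable_of_abs_le (h.stronglyMeasurable_inv_hawkinsY _)
      (h.inv_hawkinsY_le _)) hintegrable, ih, h.integral_mul_sieveInd (by omega) hm hb]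
    simp_rw [hcancel]
    rw [harmonic_succ]
    push_cast
    simp [add_assoc]

theorem ae_exists_tendsto_inv_hawkinsY_sub_harmonic (h : IsHawkinsSieve μ α) :
    ∀ᵐ ω ∂μ, ∃ c, Tendsto (fun n : ℕ => (hawkinsY (α ω) (n + 2))⁻¹ - harmonic n) atTop
      (nhds c) := by
  have hsq : ∀ (n : ℕ) ω, (((n + 1 : ℝ) * hawkinsY (α ω) (n + 2))⁻¹) ^ 2
      * hawkinsY (α ω) (n + 2) = (((n : ℝ) + 1) ^ 2)⁻¹ * (hawkinsY (α ω) (n + 2))⁻¹ :=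
    fun n ω => by
      have := (hawkinsY_pos (h.mem_ge_two ω) (n + 2)).ne'
      field_simp
  have hsum : Summable fun n : ℕ => ∫ ω, (((n + 1 : ℝ) * hawkinsY (α ω) (n + 2))⁻¹) ^ 2
      * hawkinsY (α ω) (n + 2) ∂μ := by
    simp_rw [hsq, integral_const_mul, h.integral_inv_hawkinsY]
    refine (summable_nat_add_one_rpow_neg_three_halves.mul_left 4).of_nonneg_of_le
      (fun n => ?_) fun n => ?_
    · have : (0 : ℚ) ≤ harmonic n := Finset.sum_nonneg fun i _ => by positivity
      have : (0 : ℝ) ≤ harmonic n := by exact_mod_cast this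
      positivity
    · have hn : (0 : ℝ) < (n : ℝ) + 1 := by positivity
      calc (((n : ℝ) + 1) ^ 2)⁻¹ * (1 + harmonic n)
          ≤ (((n : ℝ) + 1) ^ 2)⁻¹ * (4 * ((n : ℝ) + 1) ^ (1 / 2 : ℝ)) := by
            gcongr; exact one_add_harmonic_le n
        _ = 4 * (((n : ℝ) + 1) ^ (-2 : ℝ) * ((n : ℝ) + 1) ^ (1 / 2 : ℝ)) := by
            rw [Real.rpow_neg hn.le, Real.rpow_two]; ring
        _ = 4 * ((n : ℝ) + 1) ^ (-(3 / 2) : ℝ) := by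
            rw [← Real.rpow_add hn]; norm_num
  filter_upwards [h.ae_exists_tendsto_sum_mul_sieveInd_sub le_rfl
    h.stronglyMeasurable_inv_mul_hawkinsY
    (fun n => ⟨2 ^ (n + 2), h.abs_inv_mul_hawkinsY_le n⟩) hsum] with ω ⟨c, hc⟩
  refine ⟨1 + c, (hc.const_add 1).congr fun N => ?_⟩
  induction N with
  | zero => simp [hawkinsY_two (h.mem_ge_two ω)]
  | succ n ih =>
    have := (hawkinsY_pos (h.mem_ge_two ω) (n + 2)).ne'
    rw [Finset.sum_range_succ, ← add_assoc, ih, show n + 1 + 2 = n + 3 by rfl,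
      inv_hawkinsY_succ (h.mem_ge_two ω), harmonic_succ]
    push_cast
    field_simp
    ring

/-- The weighted sums of the differences obtained by replacing, in the indicator of a
progression, the indicator of its `j`-th term by its conditional probability converge. -/
theorem ae_exists_tendsto_sum_progression (h : IsHawkinsSieve μ α) {d : ℕ} (hd : 0 < d)
    (j p : ℕ) :
    ∀ᵐ ω ∂μ, ∃ c, Tendsto (fun N => ∑ n ∈ Finset.range N,
      ((n : ℝ) + 1) ^ (-(3 / 4) : ℝ) * (hawkinsY (α ω) (n + 2) ^ p *
        ∏ i ∈ Finset.range j, sieveInd (α ω) (n + 2 + i * d)) *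
        (sieveInd (α ω) (n + 2 + j * d) - hawkinsY (α ω) (n + 2 + j * d))) atTop (nhds c) := by
  have := h.isProb
  set g : ℕ → Ω → ℝ := fun n ω => ((n : ℝ) + 1) ^ (-(3 / 4) : ℝ) *
    (hawkinsY (α ω) (n + 2) ^ p * ∏ i ∈ Finset.range j, sieveInd (α ω) (n + 2 + i * d)) with hg
  have hgm : ∀ n, StronglyMeasurable[sieveSigma α (n + (2 + j * d))] (g n) := fun n =>
    stronglyMeasurable_const.mul
      ((((h.stronglyMeasurable_hawkinsY (n + 2)).mono (sieveSigma_mono α (by omega))).pow p).mul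
        (Finset.stronglyMeasurable_fun_prod _ fun i hi => h.stronglyMeasurable_sieveInd (by
          have := Nat.mul_lt_mul_of_pos_right (Finset.mem_range.1 hi) hd
          omega)))
  have hgb : ∀ n ω, |g n ω| ≤ ((n : ℝ) + 1) ^ (-(3 / 4) : ℝ) := fun n ω => by
    have hy := (hawkinsY_pos (h.mem_ge_two ω) (n + 2)).le
    have hp : 0 ≤ ∏ i ∈ Finset.range j, sieveInd (α ω) (n + 2 + i * d) :=
      Finset.prod_nonneg fun i _ => sieveInd_nonneg _ _
    have hp1 : ∏ i ∈ Finset.range j, sieveInd (α ω) (n + 2 + i * d) ≤ 1 :=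
      Finset.prod_le_one (fun i _ => sieveInd_nonneg _ _) fun i _ => sieveInd_le_one _ _
    rw [hg, abs_of_nonneg (by positivity)]
    exact mul_le_of_le_one_right (by positivity)
      (mul_le_one₀ (pow_le_one₀ hy (hawkinsY_le_one (h.mem_ge_two ω) _)) hp hp1)
  have hsum : Summable fun n => ∫ ω, g n ω ^ 2 * hawkinsY (α ω) (n + (2 + j * d)) ∂μ := by
    refine summable_nat_add_one_rpow_neg_three_halves.of_nonneg_of_le (fun n => ?_) fun n => ?_
    · exact integral_nonneg fun ω =>
        mul_nonneg (sq_nonneg _) (hawkinsY_pos (h.mem_ge_two ω) _).le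
    · have hle : ∀ ω, g n ω ^ 2 * hawkinsY (α ω) (n + (2 + j * d))
          ≤ ((n : ℝ) + 1) ^ (-(3 / 2) : ℝ) := fun ω => by
        refine (mul_le_of_le_one_right (sq_nonneg _)
          (hawkinsY_le_one (h.mem_ge_two ω) _)).trans ?_
        refine (sq_le_sq' (abs_le.1 (hgb n ω)).1 (abs_le.1 (hgb n ω)).2).trans_eq ?_
        rw [← Real.rpow_natCast, ← Real.rpow_mul (by positivity)]
        norm_num
      calc ∫ ω, g n ω ^ 2 * hawkinsY (α ω) (n + (2 + j * d)) ∂μ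
          ≤ ∫ _, ((n : ℝ) + 1) ^ (-(3 / 2) : ℝ) ∂μ := by
            refine integral_mono_of_nonneg (ae_of_all _ fun ω => ?_) (integrable_const _)
              (ae_of_all _ hle)
            exact mul_nonneg (sq_nonneg _) (hawkinsY_pos (h.mem_ge_two ω) _).le
        _ = _ := by simp
  have := h.ae_exists_tendsto_sum_mul_sieveInd_sub (Nat.le_add_right 2 (j * d)) hgm
    (fun n => ⟨_, hgb n⟩) hsum
  simpa only [hg, ← add_assoc] using this

end IsHawkinsSieve

end Sieve

/-- Abel summation: if the partial sums of `z` are bounded by `C` and the weights `b` are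
nonnegative and nondecreasing, then the weighted partial sums are bounded by `2 * C * b N`. -/
theorem abs_sum_mul_le_of_abs_sum_le {z b : ℕ → ℝ} {C : ℝ} (hb : Monotone b)
    (hb0 : ∀ n, 0 ≤ b n) (hz : ∀ N, |∑ n ∈ Finset.range N, z n| ≤ C) (N : ℕ) :
    |∑ n ∈ Finset.range N, b n * z n| ≤ 2 * C * b N := by
  have hC : 0 ≤ C := (abs_nonneg _).trans (hz 0)
  have key : |∑ n ∈ Finset.range N, b n * z n - b N * ∑ n ∈ Finset.range N, z n|
      ≤ C * (b N - b 0) := by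
    induction N with
    | zero => simp
    | succ N ih =>
      have heq : ∑ n ∈ Finset.range (N + 1), b n * z n
          - b (N + 1) * ∑ n ∈ Finset.range (N + 1), z n
          = (∑ n ∈ Finset.range N, b n * z n - b N * ∑ n ∈ Finset.range N, z n)
            - (b (N + 1) - b N) * ∑ n ∈ Finset.range (N + 1), z n := by
        rw [Finset.sum_range_succ, Finset.sum_range_succ]; ring
      have h1 : 0 ≤ b (N + 1) - b N := sub_nonneg.2 (hb N.le_succ)
      have h2 : |(b (N + 1) - b N) * ∑ n ∈ Finset.range (N + 1), z n|
          ≤ (b (N + 1) - b N) * C := by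
        rw [abs_mul, abs_of_nonneg h1]
        exact mul_le_mul_of_nonneg_left (hz _) h1
      rw [heq]
      calc _ ≤ C * (b N - b 0) + (b (N + 1) - b N) * C := (abs_sub _ _).trans (add_le_add ih h2)
        _ = _ := by ring
  have h3 : |b N * ∑ n ∈ Finset.range N, z n| ≤ b N * C := by
    rw [abs_mul, abs_of_nonneg (hb0 N)]
    exact mul_le_mul_of_nonneg_left (hz N) (hb0 N)
  have h4 := abs_add_le (∑ n ∈ Finset.range N, b n * z n - b N * ∑ n ∈ Finset.range N, z n)
    (b N * ∑ n ∈ Finset.range N, z n)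
  rw [sub_add_cancel] at h4
  nlinarith [mul_nonneg hC (hb0 0)]

theorem prod_sub_pow_eq_sum (a : ℕ → ℝ) (y : ℝ) (l : ℕ) :
    ∏ j ∈ Finset.range l, a j - y ^ l
      = ∑ j ∈ Finset.range l, y ^ (l - 1 - j) * (∏ i ∈ Finset.range j, a i) * (a j - y) := by
  induction l with
  | zero => simp
  | succ l ih =>
    have hshift : ∀ j ∈ Finset.range l,
        y ^ (l + 1 - 1 - j) * (∏ i ∈ Finset.range j, a i) * (a j - y)
          = y * (y ^ (l - 1 - j) * (∏ i ∈ Finset.range j, a i) * (a j - y)) := fun j hj => by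
      have : l + 1 - 1 - j = (l - 1 - j) + 1 := by have := Finset.mem_range.1 hj; omega
      rw [this, pow_succ]; ring
    rw [Finset.prod_range_succ, Finset.sum_range_succ, Finset.sum_congr rfl hshift,
      ← Finset.mul_sum, ← ih]
    simp only [add_tsub_cancel_right, tsub_self, pow_zero, pow_succ]
    ring

section Asymptotics

theorem tendsto_rpow_neg_mul_log_pow (l : ℕ) {r : ℝ} (hr : 0 < r) :
    Tendsto (fun x : ℝ => x ^ (-r) * Real.log x ^ l) atTop (nhds 0) := by
  have := (isLittleO_log_rpow_rpow_atTop (l : ℝ) hr).tendsto_div_nhds_zero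
  refine this.congr' ?_
  filter_upwards [eventually_gt_atTop 0] with x hx
  rw [Real.rpow_neg hx.le, Real.rpow_natCast, div_eq_inv_mul]

theorem tendsto_log_pow_div (l : ℕ) :
    Tendsto (fun x : ℝ => Real.log x ^ l / x) atTop (nhds 0) := by
  refine (tendsto_rpow_neg_mul_log_pow l one_pos).congr' ?_
  filter_upwards [eventually_gt_atTop 0] with x hx
  rw [Real.rpow_neg_one, div_eq_inv_mul]

theorem tendsto_div_log_pow_atTop (l : ℕ) :
    Tendsto (fun x : ℝ => x / Real.log x ^ l) atTop atTop := by
  have h : Tendsto (fun x : ℝ => Real.log x ^ l / x) atTop (nhdsWithin (0 : ℝ) (Set.Ioi 0)) := by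
    refine tendsto_nhdsWithin_iff.2 ⟨tendsto_log_pow_div l, ?_⟩
    filter_upwards [eventually_gt_atTop 1] with x hx
    have hlog := Real.log_pos hx
    exact div_pos (pow_pos hlog l) (zero_lt_one.trans hx)
  exact h.inv_tendsto_nhdsGT_zero.congr fun x => by simp

theorem tendsto_log_floor_div_log (l : ℕ) :
    Tendsto (fun x : ℝ => Real.log (⌊x / Real.log x ^ l⌋₊ : ℝ) / Real.log x) atTop (nhds 1) := by
  have hu := tendsto_div_log_pow_atTop l
  have h1 : Tendsto (fun x : ℝ => Real.log (⌊x / Real.log x ^ l⌋₊ : ℝ)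
      / Real.log (x / Real.log x ^ l)) atTop (nhds 1) := by
    have h := ((isEquivalent_nat_floor (R := ℝ)).log tendsto_id).comp_tendsto hu
    refine (isEquivalent_iff_tendsto_one ?_).1 h
    filter_upwards [(Real.tendsto_log_atTop.comp hu).eventually_gt_atTop 0] with x hx
    exact hx.ne'
  have h2 : Tendsto (fun x : ℝ => Real.log (x / Real.log x ^ l) / Real.log x) atTop
      (nhds 1) := by
    have h := (((Real.isLittleO_log_id_atTop.comp_tendsto
      Real.tendsto_log_atTop).tendsto_div_nhds_zero).const_mul (l : ℝ)).const_sub 1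
    simp only [mul_zero, sub_zero] at h
    refine h.congr' ?_
    filter_upwards [eventually_gt_atTop 1] with x hx
    have hlog := Real.log_pos hx
    rw [Real.log_div (by positivity) (by positivity), Real.log_pow]
    simp only [Function.comp_apply, id]
    field_simp
  have h3 := h1.mul h2
  rw [one_mul] at h3
  refine h3.congr' ?_
  filter_upwards [(Real.tendsto_log_atTop.comp hu).eventually_gt_atTop 0] with x hx
  exact div_mul_div_cancel₀ (ne_of_gt hx)

end Asymptotics

section Counting

variable {A : Set ℕ}

theorem tendsto_log_mul_hawkinsY (hA : ∀ n ∈ A, 2 ≤ n) {c : ℝ}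
    (hc : Tendsto (fun n : ℕ => (hawkinsY A (n + 2))⁻¹ - harmonic n) atTop (nhds c)) :
    Tendsto (fun m : ℕ => Real.log m * hawkinsY A m) atTop (nhds 1) := by
  have hlog : Tendsto (fun n : ℕ => Real.log n) atTop atTop :=
    Real.tendsto_log_atTop.comp tendsto_natCast_atTop_atTop
  have h1 : Tendsto (fun n : ℕ => (hawkinsY A (n + 2))⁻¹ - Real.log n) atTop
      (nhds (c + Real.eulerMascheroniConstant)) :=
    (hc.add Real.tendsto_harmonic_sub_log).congr fun n => by ring
  have h2 : Tendsto (fun n : ℕ => (hawkinsY A (n + 2))⁻¹ / Real.log n) atTop (nhds 1) := by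
    have := (h1.div_atTop hlog).add_const 1
    rw [zero_add] at this
    refine this.congr' ?_
    filter_upwards [hlog.eventually_gt_atTop 0] with n hn
    field_simp
    ring
  have h3 : Tendsto (fun n : ℕ => Real.log ((n + 2 : ℕ) : ℝ) / Real.log n) atTop (nhds 1) := by
    have h4 : (fun n : ℕ => ((n + 2 : ℕ) : ℝ)) ~[atTop] fun n : ℕ => (n : ℝ) := by
      refine isEquivalent_of_tendsto_one ?_
      have := ((tendsto_const_nhds (x := (2 : ℝ))).div_atTop
        (tendsto_natCast_atTop_atTop (R := ℝ))).const_add 1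
      rw [add_zero] at this
      refine this.congr' ?_
      filter_upwards [eventually_gt_atTop 0] with n hn
      have : (n : ℝ) ≠ 0 := by exact_mod_cast hn.ne'
      simp only [Pi.div_apply]
      push_cast
      field_simp
    refine (isEquivalent_iff_tendsto_one ?_).1 (h4.log tendsto_natCast_atTop_atTop)
    filter_upwards [hlog.eventually_gt_atTop 0] with n hn
    exact hn.ne'
  have h5 := h3.div h2 one_ne_zero
  rw [div_one] at h5
  refine (tendsto_add_atTop_iff_nat 2).1 (h5.congr' ?_)
  filter_upwards [hlog.eventually_gt_atTop 0] with n hn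
  have := (hawkinsY_pos hA (n + 2)).ne'
  simp only [Pi.div_apply]
  field_simp

theorem sum_hawkinsY_pow_le (hA : ∀ n ∈ A, 2 ≤ n) (l K N : ℕ) :
    ∑ n ∈ Finset.range N, hawkinsY A (n + 2) ^ l ≤ K + N * hawkinsY A K ^ l := by
  have hterm : ∀ n ∈ Finset.range N, hawkinsY A (n + 2) ^ l
      ≤ (if n ∈ Finset.range K then 1 else 0) + hawkinsY A K ^ l := fun n _ => by
    have h0 := (hawkinsY_pos hA K).le
    split_ifs with hn
    · have := pow_le_one₀ (n := l) (hawkinsY_pos hA (n + 2)).le (hawkinsY_le_one hA _)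
      have : 0 ≤ hawkinsY A K ^ l := by positivity
      linarith
    · rw [zero_add]
      have hK : K ≤ n + 2 := by rw [Finset.mem_range] at hn; omega
      exact pow_le_pow_left₀ (hawkinsY_pos hA _).le (hawkinsY_antitone hA hK) l
  refine (Finset.sum_le_sum hterm).trans ?_
  rw [Finset.sum_add_distrib, Finset.sum_const, Finset.card_range, nsmul_eq_mul,
    Finset.sum_ite_mem, Finset.sum_const, nsmul_eq_mul, mul_one]
  gcongr
  exact (Finset.card_le_card Finset.inter_subset_right).trans_eq (Finset.card_range K)

theorem le_sum_hawkinsY_pow (hA : ∀ n ∈ A, 2 ≤ n) (l N : ℕ) :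
    N * hawkinsY A (N + 1) ^ l ≤ ∑ n ∈ Finset.range N, hawkinsY A (n + 2) ^ l := by
  have := Finset.card_nsmul_le_sum (Finset.range N) (fun n => hawkinsY A (n + 2) ^ l)
    (hawkinsY A (N + 1) ^ l) fun n hn =>
      pow_le_pow_left₀ (hawkinsY_pos hA _).le
        (hawkinsY_antitone hA (by have := Finset.mem_range.1 hn; omega)) l
  simpa using this

theorem tendsto_sum_hawkinsY_pow (hA : ∀ n ∈ A, 2 ≤ n)
    (hlog : Tendsto (fun m : ℕ => Real.log m * hawkinsY A m) atTop (nhds 1)) (l : ℕ) :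
    Tendsto (fun N : ℕ => (∑ n ∈ Finset.range N, hawkinsY A (n + 2) ^ l)
      * (Real.log ((N + 1 : ℕ) : ℝ) ^ l / ((N + 1 : ℕ) : ℝ))) atTop (nhds 1) := by
  have hcast : Tendsto (fun N : ℕ => ((N + 1 : ℕ) : ℝ)) atTop atTop :=
    tendsto_natCast_atTop_atTop.comp (tendsto_add_atTop_nat 1)
  set K : ℝ → ℕ := fun x => ⌊x / Real.log x ^ (l + 1)⌋₊ with hK
  have hupper : Tendsto (fun x : ℝ => (Real.log x)⁻¹ + (Real.log x * hawkinsY A (K x)) ^ l)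
      atTop (nhds 1) := by
    have h1 : Tendsto (fun x : ℝ => Real.log x * hawkinsY A (K x)) atTop (nhds 1) := by
      have hKtop : Tendsto K atTop atTop :=
        tendsto_nat_floor_atTop.comp (tendsto_div_log_pow_atTop (l + 1))
      have hratio := tendsto_log_floor_div_log (l + 1)
      have := (hlog.comp hKtop).div hratio one_ne_zero
      rw [div_one] at this
      refine this.congr' ?_
      filter_upwards [hKtop.eventually_gt_atTop 1, eventually_gt_atTop 1] with x hx hx1
      have h2 : 0 < Real.log (K x : ℝ) := Real.log_pos (by exact_mod_cast hx)
      have h3 := Real.log_pos hx1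
      simp only [Pi.div_apply, Function.comp_apply]
      change Real.log (K x) * hawkinsY A (K x) / (Real.log (K x) / Real.log x) = _
      field_simp
    have := (tendsto_inv_atTop_zero.comp Real.tendsto_log_atTop).add (h1.pow l)
    simpa using this
  have hlower : Tendsto (fun N : ℕ => (N : ℝ) / ((N : ℝ) + 1)
      * (Real.log ((N + 1 : ℕ) : ℝ) * hawkinsY A (N + 1)) ^ l) atTop (nhds 1) := by
    have := (tendsto_natCast_div_add_atTop (1 : ℝ)).mul
      (((tendsto_add_atTop_iff_nat 1).2 hlog).pow l)
    simpa using this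
  refine tendsto_of_tendsto_of_tendsto_of_le_of_le' hlower (hupper.comp hcast) ?_ ?_
  · refine Eventually.of_forall fun N => ?_
    have hx : (0 : ℝ) < ((N + 1 : ℕ) : ℝ) := by positivity
    have hl0 : 0 ≤ Real.log ((N + 1 : ℕ) : ℝ) := Real.log_natCast_nonneg _
    calc _ = N * hawkinsY A (N + 1) ^ l
          * (Real.log ((N + 1 : ℕ) : ℝ) ^ l / ((N + 1 : ℕ) : ℝ)) := by
          rw [mul_pow]; push_cast; ring
      _ ≤ _ := mul_le_mul_of_nonneg_right (le_sum_hawkinsY_pow hA l N) (by positivity)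
  · filter_upwards [hcast.eventually_gt_atTop 1] with N hN
    set x : ℝ := ((N + 1 : ℕ) : ℝ) with hxdef
    have hl0 : 0 < Real.log x := Real.log_pos hN
    have hx : 0 < x := by linarith
    have hNx : (N : ℝ) ≤ x := by rw [hxdef]; push_cast; linarith
    have hKx : (K x : ℝ) ≤ x / Real.log x ^ (l + 1) := Nat.floor_le (by positivity)
    have hy := (hawkinsY_pos hA (K x)).le
    calc _ ≤ (K x + N * hawkinsY A (K x) ^ l) * (Real.log x ^ l / x) :=
          mul_le_mul_of_nonneg_right (sum_hawkinsY_pow_le hA l _ N) (by positivity)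
      _ ≤ (x / Real.log x ^ (l + 1) + x * hawkinsY A (K x) ^ l) * (Real.log x ^ l / x) := by
          gcongr
      _ = _ := by
          simp only [Function.comp_apply]
          rw [← hxdef, mul_pow]
          field_simp
          ring

theorem piAP_succ (hA : ∀ n ∈ A, 2 ≤ n) {d l : ℕ} (hl : 0 < l) (N : ℕ) :
    (piAP A d l (N + 1) : ℝ)
      = ∑ n ∈ Finset.range N, ∏ j ∈ Finset.range l, sieveInd A (n + 2 + j * d) := by
  have hprod : ∀ m, (if ∀ j < l, m + j * d ∈ A then (1 : ℝ) else 0)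
      = ∏ j ∈ Finset.range l, sieveInd A (m + j * d) := fun m => by
    simp [sieveInd, Finset.prod_ite_zero]
  have hzero : ∀ m, m < 2 → ∏ j ∈ Finset.range l, sieveInd A (m + j * d) = 0 := fun m hm =>
    Finset.prod_eq_zero (Finset.mem_range.2 hl) (by
      have : m ∉ A := fun h => absurd (hA m h) (by omega)
      simp [sieveInd, this])
  rw [piAP, Finset.card_filter, Nat.cast_sum]
  push_cast
  simp_rw [hprod]
  rw [Finset.sum_range_succ', Finset.sum_range_succ', hzero _ (by norm_num),
    hzero _ (by norm_num), add_zero, add_zero]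

theorem sum_abs_hawkinsY_add_sub_le (hA : ∀ n ∈ A, 2 ≤ n) (s N : ℕ) :
    ∑ n ∈ Finset.range N, |hawkinsY A (n + 2 + s) - hawkinsY A (n + 2)|
      ≤ 4 * s * ((N : ℝ) + 1) ^ (3 / 4 : ℝ) := by
  have hterm : ∀ n ∈ Finset.range N, |hawkinsY A (n + 2 + s) - hawkinsY A (n + 2)|
      ≤ s * ((n : ℝ) + 1)⁻¹ := fun n _ => by
    refine (abs_hawkinsY_add_sub_le hA (by omega) s).trans ?_
    rw [div_eq_mul_inv]
    gcongr
    push_cast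
    linarith
  have hharm : ∑ n ∈ Finset.range N, ((n : ℝ) + 1)⁻¹ = harmonic N := by
    simp [harmonic]
  refine (Finset.sum_le_sum hterm).trans ?_
  rw [← Finset.mul_sum, hharm]
  have h1 := one_add_harmonic_le N
  have h2 : ((N : ℝ) + 1) ^ (1 / 2 : ℝ) ≤ ((N : ℝ) + 1) ^ (3 / 4 : ℝ) :=
    Real.rpow_le_rpow_of_exponent_le (by linarith [Nat.cast_nonneg (α := ℝ) N]) (by norm_num)
  have h3 : (harmonic N : ℝ) ≤ 4 * ((N : ℝ) + 1) ^ (3 / 4 : ℝ) := by linarith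
  calc (s : ℝ) * harmonic N ≤ s * (4 * ((N : ℝ) + 1) ^ (3 / 4 : ℝ)) := by gcongr
    _ = _ := by ring

theorem exists_abs_sum_prod_sub_pow_le (hA : ∀ n ∈ A, 2 ≤ n) {d l : ℕ}
    (hconv : ∀ j p : ℕ, ∃ c, Tendsto (fun N => ∑ n ∈ Finset.range N,
      ((n : ℝ) + 1) ^ (-(3 / 4) : ℝ) * (hawkinsY A (n + 2) ^ p *
        ∏ i ∈ Finset.range j, sieveInd A (n + 2 + i * d)) *
        (sieveInd A (n + 2 + j * d) - hawkinsY A (n + 2 + j * d))) atTop (nhds c)) :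
    ∃ C, ∀ N : ℕ, |∑ n ∈ Finset.range N, (∏ j ∈ Finset.range l, sieveInd A (n + 2 + j * d)
      - hawkinsY A (n + 2) ^ l)| ≤ C * ((N : ℝ) + 1) ^ (3 / 4 : ℝ) := by
  set W : ℕ → ℕ → ℝ := fun j n => hawkinsY A (n + 2) ^ (l - 1 - j) *
    ∏ i ∈ Finset.range j, sieveInd A (n + 2 + i * d) with hW
  have hWabs : ∀ j n, |W j n| ≤ 1 := fun j n => by
    have hy := (hawkinsY_pos hA (n + 2)).le
    have hp : 0 ≤ ∏ i ∈ Finset.range j, sieveInd A (n + 2 + i * d) :=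
      Finset.prod_nonneg fun i _ => sieveInd_nonneg _ _
    have hp1 : ∏ i ∈ Finset.range j, sieveInd A (n + 2 + i * d) ≤ 1 :=
      Finset.prod_le_one (fun i _ => sieveInd_nonneg _ _) fun i _ => sieveInd_le_one _ _
    rw [hW, abs_of_nonneg (by positivity)]
    exact mul_le_one₀ (pow_le_one₀ hy (hawkinsY_le_one hA _)) hp hp1
  have hmart : ∀ j, ∃ C, ∀ N : ℕ, |∑ n ∈ Finset.range N,
      W j n * (sieveInd A (n + 2 + j * d) - hawkinsY A (n + 2 + j * d))|
        ≤ C * ((N : ℝ) + 1) ^ (3 / 4 : ℝ) := fun j => by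
    obtain ⟨c, hc⟩ := hconv j (l - 1 - j)
    obtain ⟨C, hC⟩ := (Metric.isBounded_range_of_tendsto _ hc).exists_norm_le
    refine ⟨2 * C, fun N => ?_⟩
    have := abs_sum_mul_le_of_abs_sum_le (b := fun n : ℕ => ((n : ℝ) + 1) ^ (3 / 4 : ℝ))
      (fun m n hmn => Real.rpow_le_rpow (by positivity) (by gcongr) (by norm_num))
      (fun n => by positivity) (fun N => hC _ ⟨N, rfl⟩) N
    refine le_trans (le_of_eq ?_) this
    congr 1
    refine Finset.sum_congr rfl fun n _ => ?_
    have hn : ((n : ℝ) + 1) ^ (3 / 4 : ℝ) * ((n : ℝ) + 1) ^ (-(3 / 4) : ℝ) = 1 := by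
      rw [← Real.rpow_add (by positivity)]; simp
    simp only [hW]
    linear_combination -(hawkinsY A (n + 2) ^ (l - 1 - j) *
      (∏ i ∈ Finset.range j, sieveInd A (n + 2 + i * d)) *
      (sieveInd A (n + 2 + j * d) - hawkinsY A (n + 2 + j * d))) * hn
  choose C hC using hmart
  refine ⟨∑ j ∈ Finset.range l, (C j + 4 * ((j * d : ℕ) : ℝ)), fun N => ?_⟩
  have hsplit : ∑ n ∈ Finset.range N, (∏ j ∈ Finset.range l, sieveInd A (n + 2 + j * d)
      - hawkinsY A (n + 2) ^ l) = ∑ j ∈ Finset.range l,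
        (∑ n ∈ Finset.range N,
            W j n * (sieveInd A (n + 2 + j * d) - hawkinsY A (n + 2 + j * d))
          + ∑ n ∈ Finset.range N,
            W j n * (hawkinsY A (n + 2 + j * d) - hawkinsY A (n + 2))) := by
    simp_rw [prod_sub_pow_eq_sum, ← Finset.sum_add_distrib]
    rw [Finset.sum_comm]
    refine Finset.sum_congr rfl fun j _ => Finset.sum_congr rfl fun n _ => ?_
    simp only [hW]
    ring
  rw [hsplit, Finset.sum_mul]
  refine (Finset.abs_sum_le_sum_abs _ _).trans (Finset.sum_le_sum fun j _ => ?_)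
  rw [add_mul]
  refine (abs_add_le _ _).trans (add_le_add (hC j N) ?_)
  refine (Finset.abs_sum_le_sum_abs _ _).trans
    ((Finset.sum_le_sum fun n _ => ?_).trans (sum_abs_hawkinsY_add_sub_le hA (j * d) N))
  rw [abs_mul]
  exact mul_le_of_le_one_left (abs_nonneg _) (hWabs j n)

theorem tendsto_piAP_div (hA : ∀ n ∈ A, 2 ≤ n) {d l : ℕ} (hl : 0 < l)
    (hlog : Tendsto (fun m : ℕ => Real.log m * hawkinsY A m) atTop (nhds 1))
    (hconv : ∀ j p : ℕ, ∃ c, Tendsto (fun N => ∑ n ∈ Finset.range N,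
      ((n : ℝ) + 1) ^ (-(3 / 4) : ℝ) * (hawkinsY A (n + 2) ^ p *
        ∏ i ∈ Finset.range j, sieveInd A (n + 2 + i * d)) *
        (sieveInd A (n + 2 + j * d) - hawkinsY A (n + 2 + j * d))) atTop (nhds c)) :
    Tendsto (fun x : ℕ => (piAP A d l x : ℝ) / ((x : ℝ) / Real.log x ^ l)) atTop (nhds 1) := by
  obtain ⟨C, hC⟩ := exists_abs_sum_prod_sub_pow_le (l := l) hA hconv
  have hcast : Tendsto (fun N : ℕ => ((N + 1 : ℕ) : ℝ)) atTop atTop :=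
    tendsto_natCast_atTop_atTop.comp (tendsto_add_atTop_nat 1)
  have herr : Tendsto (fun N : ℕ => (∑ n ∈ Finset.range N,
      (∏ j ∈ Finset.range l, sieveInd A (n + 2 + j * d) - hawkinsY A (n + 2) ^ l))
        * (Real.log ((N + 1 : ℕ) : ℝ) ^ l / ((N + 1 : ℕ) : ℝ))) atTop (nhds 0) := by
    have hlim := ((tendsto_rpow_neg_mul_log_pow l (r := 1 / 4) (by norm_num)).comp
      hcast).const_mul C
    rw [mul_zero] at hlim
    refine squeeze_zero_norm (fun N => ?_) hlim
    have hx : (0 : ℝ) < (N : ℝ) + 1 := by positivity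
    have hl0 : 0 ≤ Real.log ((N + 1 : ℕ) : ℝ) ^ l / ((N + 1 : ℕ) : ℝ) := by
      have := Real.log_natCast_nonneg (N + 1)
      positivity
    have hpow : ((N : ℝ) + 1) ^ (3 / 4 : ℝ) / ((N : ℝ) + 1) = ((N : ℝ) + 1) ^ (-(1 / 4) : ℝ) := by
      rw [div_eq_mul_inv, ← Real.rpow_neg_one, ← Real.rpow_add hx]; norm_num
    rw [Real.norm_eq_abs, abs_mul, abs_of_nonneg hl0]
    refine (mul_le_mul_of_nonneg_right (hC N) hl0).trans_eq ?_
    simp only [Function.comp_apply]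
    push_cast
    rw [← hpow]
    ring
  have hsum := herr.add (tendsto_sum_hawkinsY_pow hA hlog l)
  rw [zero_add] at hsum
  refine (tendsto_add_atTop_iff_nat 1).1 (hsum.congr fun N => ?_)
  rw [← add_mul, ← Finset.sum_add_distrib, piAP_succ hA hl, div_div_eq_mul_div, mul_div_assoc]
  simp

end Counting

theorem arithmetic_progressions_hawkins (d l : ℕ) (hd : 0 < d) (hl : 2 ≤ l)
    {Ω : Type*} [MeasurableSpace Ω] (μ : Measure Ω) (α : Ω → Set ℕ)
    (h : IsHawkinsSieve μ α) :
    ∀ᵐ ω ∂μ, Tendsto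
      (fun x : ℕ => (piAP (α ω) d l x : ℝ) / ((x : ℝ) / (Real.log x) ^ l))
      atTop (nhds 1) := by
  have hconv := ae_all_iff.2 fun j => ae_all_iff.2 fun p =>
    h.ae_exists_tendsto_sum_progression hd j p
  filter_upwards [h.ae_exists_tendsto_inv_hawkinsY_sub_harmonic, hconv] with ω ⟨c, hc⟩ hω
  exact tendsto_piAP_div (h.mem_ge_two ω) (by omega)
    (tendsto_log_mul_hawkinsY (h.mem_ge_two ω) hc) hω
end

section
/- Let r, s, t be non-negative integers with r ≤ t, and set c(j,r) := r(r+1)⋯(r+j−1)/(s+1)^{j+1}. Then, as n → ∞, Σ_{k=2}^{n} k^s/M_k^r = n^{s+1}/((s+1) M_n^r) + Σ_{j=1}^{t−r−1} c(j,r) n^{s+1}/M_n^{r+j} + O(n^{s+1}/M_n^t). -/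
open MeasureTheory Filter Finset Asymptotics
open scoped Classical

lemma mharm_succ (m : ℕ) : Mharm (m + 3) = Mharm (m + 2) + 1 / ((m : ℝ) + 1) := by
  simp only [Mharm, Nat.add_sub_cancel, show m + 3 - 2 = m + 1 by omega]
  rw [Finset.sum_Icc_succ_top (by omega)]
  push_cast
  ring

lemma one_le_mharm (k : ℕ) : 1 ≤ Mharm k :=
  le_add_of_nonneg_right (Finset.sum_nonneg fun _ _ => by positivity)

lemma mharm_add_two (m : ℕ) : Mharm (m + 2) = 1 + (harmonic m : ℝ) := by
  simp [Mharm, harmonic_eq_sum_Icc]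

lemma tendsto_mharm_atTop : Tendsto Mharm atTop atTop := by
  rw [← tendsto_add_atTop_iff_nat 2]
  simp only [mharm_add_two]
  refine tendsto_atTop_add_const_left _ _ (tendsto_atTop_mono (fun n => log_add_one_le_harmonic n) ?_)
  exact Real.tendsto_log_atTop.comp (tendsto_natCast_atTop_atTop.comp (tendsto_add_atTop_nat 1))

lemma mharm_le_log {n : ℕ} (hn : 3 ≤ n) : Mharm n ≤ 3 * Real.log n := by
  obtain ⟨m, rfl⟩ : ∃ m, n = m + 2 := ⟨n - 2, by omega⟩
  have hm : (1 : ℝ) ≤ m := by exact_mod_cast (by omega : 1 ≤ m)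
  have h1 : Real.log m ≤ Real.log ((m + 2 : ℕ) : ℝ) :=
    Real.log_le_log (by linarith) (by push_cast; linarith)
  have h2 : 1 ≤ Real.log ((m + 2 : ℕ) : ℝ) := by
    rw [Real.le_log_iff_exp_le (by positivity)]
    push_cast
    linarith [Real.exp_one_lt_d9]
  rw [mharm_add_two]
  linarith [harmonic_le_one_add_log m]

lemma mharm_pow_isBigO (t : ℕ) :
    (fun n => Mharm n ^ t) =O[atTop] fun n : ℕ => (n : ℝ) := by
  have h1 : Mharm =O[atTop] fun n : ℕ => Real.log n := by
    refine IsBigO.of_bound 3 ?_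
    filter_upwards [eventually_ge_atTop 3] with n hn
    have h := mharm_le_log hn
    have h' := one_le_mharm n
    rwa [Real.norm_of_nonneg (by linarith), Real.norm_of_nonneg (by linarith)]
  exact (h1.pow t).trans
    (((Real.isLittleO_pow_log_id_atTop (n := t)).isBigO).comp_tendsto tendsto_natCast_atTop_atTop)

lemma pow_mul_mharm_isBigO (s t : ℕ) :
    (fun n : ℕ => (n : ℝ) ^ s * Mharm n) =O[atTop]
      fun n : ℕ => (n : ℝ) ^ (s + 1) / Mharm n ^ t := by
  have h := ((isBigO_refl (fun n : ℕ => (n : ℝ) ^ s) atTop).mul (mharm_pow_isBigO (t + 1))).mul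
    (isBigO_refl (fun n : ℕ => (Mharm n ^ t)⁻¹) atTop)
  refine h.congr (fun n => ?_) fun n => ?_
  · have : Mharm n ≠ 0 := by linarith [one_le_mharm n]
    field_simp
    ring
  · rw [pow_succ, div_eq_mul_inv]

lemma one_isBigO_pow_div_mharm_pow (s t : ℕ) :
    (fun _ : ℕ => (1 : ℝ)) =O[atTop] fun n : ℕ => (n : ℝ) ^ (s + 1) / Mharm n ^ t := by
  refine IsBigO.trans (IsBigO.of_bound 1 ?_) (pow_mul_mharm_isBigO s t)
  filter_upwards [eventually_ge_atTop 1] with n hn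
  have h1 : (1 : ℝ) ≤ (n : ℝ) ^ s := one_le_pow₀ (by exact_mod_cast hn)
  rw [norm_one, one_mul, Real.norm_of_nonneg (by nlinarith [one_le_mharm n])]
  nlinarith [one_le_mharm n]

lemma abs_pow_sub_pow_sub_le {x : ℝ} (hx : 1 ≤ x) (s : ℕ) :
    |x ^ (s + 1) - (x - 1) ^ (s + 1) - (s + 1) * x ^ s| * x ≤ ((s : ℝ) + 1) ^ 2 * x ^ s := by
  induction s with
  | zero => simp
  | succ s ih =>
    set d := x ^ (s + 1) - (x - 1) ^ (s + 1) - (s + 1) * x ^ s with hd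
    have key : x ^ (s + 1 + 1) - (x - 1) ^ (s + 1 + 1) - ((s + 1 : ℕ) + 1) * x ^ (s + 1)
        = (x - 1) * d - (s + 1) * x ^ s := by
      rw [hd]; push_cast; ring
    have hx0 : 0 < x := by linarith
    have hxs : 0 < x ^ s := by positivity
    have h : |(x - 1) * d - (s + 1) * x ^ s| ≤ (x - 1) * |d| + (s + 1) * x ^ s := by
      refine (abs_sub _ _).trans_eq ?_
      rw [abs_mul, abs_of_nonneg (by linarith : 0 ≤ x - 1), 
        abs_of_nonneg (by positivity : 0 ≤ ((s : ℝ) + 1) * x ^ s)]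
    rw [key]
    calc _ ≤ ((x - 1) * |d| + (s + 1) * x ^ s) * x := by gcongr
      _ = (x - 1) * (|d| * x) + (s + 1) * x ^ s * x := by ring
      _ ≤ x * (((s : ℝ) + 1) ^ 2 * x ^ s) + (s + 1) * x ^ s * x :=
        add_le_add (mul_le_mul (by linarith) ih (by positivity) (by linarith)) le_rfl
      _ = (((s : ℝ) + 1) ^ 2 + (s + 1)) * x ^ (s + 1) := by ring
      _ ≤ _ := by
        push_cast
        gcongr
        nlinarith [(Nat.cast_nonneg s : (0 : ℝ) ≤ s)]

lemma abs_pow_sub_pow_le_mul {a b δ : ℝ} (ha : 0 ≤ a) (ha1 : a ≤ 1) (hb : 0 ≤ b) (hb1 : b ≤ 1)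
    (h : |a - b| ≤ δ) (r : ℕ) : |a ^ r - b ^ r| ≤ r * δ := by
  induction r with
  | zero => simp
  | succ r ih =>
    have e : a ^ (r + 1) - b ^ (r + 1) = a * (a ^ r - b ^ r) + b ^ r * (a - b) := by ring
    rw [e]
    refine (abs_add_le _ _).trans ?_
    rw [abs_mul, abs_mul, abs_of_nonneg ha, abs_of_nonneg (pow_nonneg hb r)]
    have h1 := mul_le_mul ha1 ih (abs_nonneg _) zero_le_one
    have h2 := mul_le_mul (pow_le_one₀ hb hb1 (n := r)) h (abs_nonneg _) zero_le_one
    push_cast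
    linarith

lemma abs_pow_sub_pow_add_le_mul_sq {a b δ : ℝ} (ha : 0 ≤ a) (ha1 : a ≤ 1) (hb : 0 ≤ b)
    (hb1 : b ≤ 1) (hδ : 0 ≤ δ) (h : a - b = -(δ * a * b)) (r : ℕ) :
    |a ^ r - b ^ r + r * δ * a ^ (r + 1)| ≤ (r : ℝ) ^ 2 * δ ^ 2 := by
  have hab : |a - b| ≤ δ := by
    rw [h, abs_neg, abs_of_nonneg (by positivity), mul_assoc]
    exact mul_le_of_le_one_right hδ (mul_le_one₀ ha1 hb hb1)
  induction r with
  | zero => simp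
  | succ r ih =>
    have e : a ^ (r + 1) - b ^ (r + 1) + (r + 1 : ℕ) * δ * a ^ (r + 1 + 1)
        = a * (a ^ r - b ^ r + r * δ * a ^ (r + 1)) + (δ * a) * (a ^ (r + 1) - b ^ (r + 1)) := by
      push_cast
      linear_combination b ^ r * h
    rw [e]
    refine (abs_add_le _ _).trans ?_
    rw [abs_mul, abs_mul, abs_of_nonneg ha, abs_of_nonneg (mul_nonneg hδ ha)]
    have h1 := mul_le_mul ha1 ih (abs_nonneg _) zero_le_one
    have h2 := mul_le_mul (mul_le_of_le_one_right hδ ha1)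
      (abs_pow_sub_pow_le_mul ha ha1 hb hb1 hab (r + 1)) (abs_nonneg _) hδ
    push_cast at h2 ⊢
    nlinarith [mul_nonneg (Nat.cast_nonneg r : (0 : ℝ) ≤ r) (sq_nonneg δ)]

/-- The discrete derivative of `k ^ (s + 1) / ((s + 1) * M_k ^ r)`, up to a relative error
`O(1 / k)`. -/
lemma exists_abs_increment_le (r s : ℕ) : ∃ C : ℝ, 0 ≤ C ∧ ∀ m : ℕ,
    |((m + 3 : ℕ) : ℝ) ^ s / Mharm (m + 3) ^ r
        - r / ((s : ℝ) + 1) * (((m + 3 : ℕ) : ℝ) ^ s / Mharm (m + 3) ^ (r + 1))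
        - (((m + 3 : ℕ) : ℝ) ^ (s + 1) / ((s + 1) * Mharm (m + 3) ^ r)
          - ((m + 2 : ℕ) : ℝ) ^ (s + 1) / ((s + 1) * Mharm (m + 2) ^ r))|
      ≤ C * (((m + 3 : ℕ) : ℝ) ^ s * (1 / ((m : ℝ) + 1))) := by
  refine ⟨(s + 1) ^ 2 + 3 * r ^ 2 + r * (2 + (s + 1) + (s + 1) ^ 2), by positivity, fun m => ?_⟩
  have hM := one_le_mharm (m + 3)
  have hM' := one_le_mharm (m + 2)
  have hsucc := mharm_succ m
  have hm : (0 : ℝ) ≤ m := Nat.cast_nonneg m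
  have hx : ((m + 3 : ℕ) : ℝ) = m + 3 := by push_cast; ring
  have hx' : ((m + 2 : ℕ) : ℝ) = (m + 3 : ℝ) - 1 := by push_cast; ring
  rw [hx, hx']
  set x : ℝ := m + 3 with hxdef
  set δ : ℝ := 1 / ((m : ℝ) + 1) with hδdef
  set a : ℝ := (Mharm (m + 3))⁻¹ with hadef
  set b : ℝ := (Mharm (m + 2))⁻¹ with hbdef
  have hδ : 0 ≤ δ := by positivity
  have hδ1 : δ ≤ 1 := by rw [hδdef, div_le_one (by positivity)]; linarith
  have hδx : x * δ = 1 + 2 * δ := by rw [hxdef, hδdef]; field_simp; ring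
  have hx1 : 1 ≤ x := by linarith
  have ha : 0 ≤ a := by positivity
  have hb : 0 ≤ b := by positivity
  have ha1 : a ≤ 1 := inv_le_one_of_one_le₀ hM
  have hb1 : b ≤ 1 := inv_le_one_of_one_le₀ hM'
  have hab : a - b = -(δ * a * b) := by
    have h1 : Mharm (m + 3) ≠ 0 := by positivity
    have h2 : Mharm (m + 2) ≠ 0 := by positivity
    have h3 : δ = Mharm (m + 3) - Mharm (m + 2) := by rw [hsucc]; ring
    rw [h3, hadef, hbdef]
    field_simp
    ring
  have hu := abs_pow_sub_pow_add_le_mul_sq ha ha1 hb hb1 hδ hab r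
  have hd := abs_pow_sub_pow_sub_le hx1 s
  set u := a ^ r - b ^ r + r * δ * a ^ (r + 1) with hudef
  set d := x ^ (s + 1) - (x - 1) ^ (s + 1) - (s + 1) * x ^ s with hddef
  have hxs : 0 < x ^ s := by positivity
  have hdδ : |d| ≤ (s + 1) ^ 2 * (x ^ s * δ) := by
    have h1 : |d| ≤ |d| * x * δ := by
      rw [mul_assoc, hδx]
      nlinarith [abs_nonneg d]
    nlinarith
  have hs : (0 : ℝ) < s + 1 := by positivity
  have e : x ^ s / Mharm (m + 3) ^ r - r / ((s : ℝ) + 1) * (x ^ s / Mharm (m + 3) ^ (r + 1))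
        - (x ^ (s + 1) / ((s + 1) * Mharm (m + 3) ^ r)
          - (x - 1) ^ (s + 1) / ((s + 1) * Mharm (m + 2) ^ r))
      = (-(d * a ^ r) - (x - 1) ^ (s + 1) * u
          + r * a ^ (r + 1) * (2 * (x ^ s * δ) - (s + 1) * (x ^ s * δ) - δ * d)) / (s + 1) := by
    have e1 : 2 * (x ^ s * δ) - (s + 1) * (x ^ s * δ) - δ * d
        = (x - 1) ^ (s + 1) * δ - x ^ s := by
      rw [hddef]
      linear_combination (- x ^ s) * hδx
    have e2 : ∀ j : ℕ, (Mharm (m + 3) ^ j)⁻¹ = a ^ j := fun j => (inv_pow _ _).symm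
    have e3 : ∀ j : ℕ, (Mharm (m + 2) ^ j)⁻¹ = b ^ j := fun j => (inv_pow _ _).symm
    rw [e1, hudef, hddef]
    simp only [div_eq_mul_inv, mul_inv, e2, e3]
    have : (s + 1 : ℝ) * (s + 1 : ℝ)⁻¹ = 1 := mul_inv_cancel₀ hs.ne'
    linear_combination (-(x ^ s * a ^ r)) * this
  rw [e, abs_div, abs_of_pos hs]
  refine (div_le_self (abs_nonneg _) (by linarith [(Nat.cast_nonneg s : (0 : ℝ) ≤ s)])).trans ?_
  have b1 : |d * a ^ r| ≤ (s + 1) ^ 2 * (x ^ s * δ) := by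
    rw [abs_mul, abs_of_nonneg (pow_nonneg ha r)]
    exact (mul_le_of_le_one_right (abs_nonneg _) (pow_le_one₀ ha ha1)).trans hdδ
  have b2 : |(x - 1) ^ (s + 1) * u| ≤ 3 * r ^ 2 * (x ^ s * δ) := by
    have hx0 : 0 ≤ x - 1 := by linarith
    rw [abs_mul, abs_of_nonneg (pow_nonneg hx0 _)]
    calc _ ≤ x ^ (s + 1) * ((r : ℝ) ^ 2 * δ ^ 2) := by
          gcongr
          linarith
      _ = (x * δ) * (r ^ 2 * (x ^ s * δ)) := by ring
      _ ≤ 3 * (r ^ 2 * (x ^ s * δ)) := by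
          gcongr
          linarith
      _ = _ := by ring
  have b3 : |r * a ^ (r + 1) * (2 * (x ^ s * δ) - (s + 1) * (x ^ s * δ) - δ * d)|
      ≤ r * (2 + (s + 1) + (s + 1) ^ 2) * (x ^ s * δ) := by
    rw [abs_mul, abs_of_nonneg (by positivity : (0 : ℝ) ≤ r * a ^ (r + 1)), mul_assoc (r : ℝ) (2 + _ + _)]
    refine mul_le_mul (mul_le_of_le_one_right (by positivity) (pow_le_one₀ ha ha1)) ?_
      (abs_nonneg _) (by positivity)
    refine (abs_sub _ _).trans ?_
    have h1 := abs_sub (2 * (x ^ s * δ)) ((s + 1) * (x ^ s * δ))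
    rw [abs_of_nonneg (by positivity : 0 ≤ 2 * (x ^ s * δ)),
      abs_of_nonneg (by positivity : 0 ≤ (s + 1) * (x ^ s * δ))] at h1
    have h2 : |δ * d| ≤ |d| := by
      rw [abs_mul, abs_of_nonneg hδ]
      exact mul_le_of_le_one_left (abs_nonneg _) hδ1
    linarith
  refine (abs_add_le _ _).trans ?_
  have h3 := abs_sub (-(d * a ^ r)) ((x - 1) ^ (s + 1) * u)
  rw [abs_neg] at h3
  linarith

lemma exists_abs_sum_sub_le (r s : ℕ) : ∃ C : ℝ, ∀ m : ℕ,
    |∑ k ∈ Finset.Icc (2 : ℕ) (m + 2), (k : ℝ) ^ s / Mharm k ^ r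
        - r / ((s : ℝ) + 1) * ∑ k ∈ Finset.Icc (2 : ℕ) (m + 2), (k : ℝ) ^ s / Mharm k ^ (r + 1)
        - ((m + 2 : ℕ) : ℝ) ^ (s + 1) / ((s + 1) * Mharm (m + 2) ^ r)|
      ≤ C * (((m + 2 : ℕ) : ℝ) ^ s * Mharm (m + 2)) := by
  obtain ⟨C, hC, h⟩ := exists_abs_increment_le r s
  obtain ⟨B, hB⟩ : ∃ B : ℝ, |∑ k ∈ Finset.Icc (2 : ℕ) (0 + 2), (k : ℝ) ^ s / Mharm k ^ r
        - r / ((s : ℝ) + 1) * ∑ k ∈ Finset.Icc (2 : ℕ) (0 + 2), (k : ℝ) ^ s / Mharm k ^ (r + 1)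
        - ((0 + 2 : ℕ) : ℝ) ^ (s + 1) / ((s + 1) * Mharm (0 + 2) ^ r)| = B := ⟨_, rfl⟩
  have hB0 : 0 ≤ B := hB ▸ abs_nonneg _
  refine ⟨C + B, fun m => ?_⟩
  induction m with
  | zero =>
    rw [hB]
    have h1 : (1 : ℝ) ≤ ((0 + 2 : ℕ) : ℝ) ^ s := one_le_pow₀ (by norm_num)
    have h2 := one_le_mul_of_one_le_of_one_le h1 (one_le_mharm (0 + 2))
    nlinarith
  | succ m ih =>
    have hm := h m
    simp only [show m + 1 + 2 = m + 2 + 1 by ring,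
      Finset.sum_Icc_succ_top (show 2 ≤ m + 2 + 1 by omega)]
    have hmono : ((m + 2 : ℕ) : ℝ) ^ s * Mharm (m + 2) ≤ ((m + 3 : ℕ) : ℝ) ^ s * Mharm (m + 2) := by
      have := one_le_mharm (m + 2)
      gcongr
      omega
    have hnn : 0 ≤ ((m + 3 : ℕ) : ℝ) ^ s * (1 / ((m : ℝ) + 1)) := by positivity
    calc _ ≤ (C + B) * (((m + 2 : ℕ) : ℝ) ^ s * Mharm (m + 2))
          + C * (((m + 3 : ℕ) : ℝ) ^ s * (1 / ((m : ℝ) + 1))) := by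
          refine le_trans (le_of_eq ?_) ((abs_add_le _ _).trans (add_le_add ih hm))
          congr 1
          ring
      _ ≤ (C + B) * (((m + 3 : ℕ) : ℝ) ^ s * Mharm (m + 2))
          + (C + B) * (((m + 3 : ℕ) : ℝ) ^ s * (1 / ((m : ℝ) + 1))) := by
          gcongr
          linarith
      _ = _ := by rw [mharm_succ]; ring

/-- Partial summation: lowers the sum with exponent `r` to the one with exponent `r + 1`. -/
lemma sum_sub_isBigO (r s t : ℕ) :
    (fun n : ℕ => ∑ k ∈ Finset.Icc 2 n, (k : ℝ) ^ s / Mharm k ^ r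
        - r / ((s : ℝ) + 1) * ∑ k ∈ Finset.Icc 2 n, (k : ℝ) ^ s / Mharm k ^ (r + 1)
        - (n : ℝ) ^ (s + 1) / ((s + 1) * Mharm n ^ r))
      =O[atTop] fun n : ℕ => (n : ℝ) ^ (s + 1) / Mharm n ^ t := by
  obtain ⟨C, hC⟩ := exists_abs_sum_sub_le r s
  refine IsBigO.trans (IsBigO.of_bound C ?_) (pow_mul_mharm_isBigO s t)
  filter_upwards [eventually_ge_atTop 2] with n hn
  obtain ⟨m, rfl⟩ : ∃ m, n = m + 2 := ⟨n - 2, by omega⟩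
  have := one_le_mharm (m + 2)
  rw [Real.norm_eq_abs, Real.norm_of_nonneg (by positivity)]
  exact hC m

lemma exists_sum_succ_le (r s : ℕ) {ε : ℝ} (hε : 0 < ε) : ∃ B : ℝ, ∀ n : ℕ,
    ∑ k ∈ Finset.Icc 2 n, (k : ℝ) ^ s / Mharm k ^ (r + 1)
      ≤ ε * ∑ k ∈ Finset.Icc 2 n, (k : ℝ) ^ s / Mharm k ^ r + B := by
  obtain ⟨K, hK⟩ := eventually_atTop.1 (tendsto_mharm_atTop.eventually_ge_atTop ε⁻¹)
  refine ⟨∑ k ∈ Finset.range K, (k : ℝ) ^ s / Mharm k ^ (r + 1), fun n => ?_⟩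
  have hpos : ∀ k, 0 < Mharm k := fun k => by linarith [one_le_mharm k]
  have hnn : ∀ j k : ℕ, 0 ≤ (k : ℝ) ^ s / Mharm k ^ j := fun j k => by
    have := hpos k
    positivity
  rw [← Finset.sum_filter_add_sum_filter_not (Finset.Icc 2 n) (fun k => K ≤ k)
    (fun k : ℕ => (k : ℝ) ^ s / Mharm k ^ (r + 1)), Finset.mul_sum]
  refine add_le_add ?_ ?_
  · refine le_trans (Finset.sum_le_sum fun k hk => ?_) (Finset.sum_le_sum_of_subset_of_nonneg
      (Finset.filter_subset (fun k => K ≤ k) _) fun k _ _ => mul_nonneg hε.le (hnn r k))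
    have h1 : (Mharm k)⁻¹ ≤ ε := inv_le_of_inv_le₀ hε (hK k (Finset.mem_filter.1 hk).2)
    calc (k : ℝ) ^ s / Mharm k ^ (r + 1) = (Mharm k)⁻¹ * ((k : ℝ) ^ s / Mharm k ^ r) := by
          have := (hpos k).ne'
          field_simp
          ring
      _ ≤ _ := mul_le_mul_of_nonneg_right h1 (hnn r k)
  · refine Finset.sum_le_sum_of_subset_of_nonneg (fun k hk => ?_) fun k _ _ => hnn _ k
    simpa using (Finset.mem_filter.1 hk).2

lemma sum_isBigO (r s : ℕ) :
    (fun n : ℕ => ∑ k ∈ Finset.Icc 2 n, (k : ℝ) ^ s / Mharm k ^ r)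
      =O[atTop] fun n : ℕ => (n : ℝ) ^ (s + 1) / Mharm n ^ r := by
  obtain ⟨B, hB⟩ := exists_sum_succ_le r s (ε := 1 / (2 * ((r : ℝ) + 1))) (by positivity)
  have hlead : (fun n : ℕ => (n : ℝ) ^ (s + 1) / ((s + 1) * Mharm n ^ r))
      =O[atTop] fun n : ℕ => (n : ℝ) ^ (s + 1) / Mharm n ^ r :=
    ((isBigO_refl _ _).const_mul_left ((s : ℝ) + 1)⁻¹).congr_left fun n => by
      simp only [div_eq_mul_inv, mul_inv]; ring
  have h := (((sum_sub_isBigO r s r).add hlead).const_mul_left 2).add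
    ((one_isBigO_pow_div_mharm_pow s r).const_mul_left (2 * (r * |B|)))
  refine IsBigO.trans (IsBigO.of_bound 1 (Eventually.of_forall fun n => ?_)) h
  set S := ∑ k ∈ Finset.Icc 2 n, (k : ℝ) ^ s / Mharm k ^ r with hS
  set T := ∑ k ∈ Finset.Icc 2 n, (k : ℝ) ^ s / Mharm k ^ (r + 1) with hT
  have hnn : ∀ j : ℕ, 0 ≤ ∑ k ∈ Finset.Icc 2 n, (k : ℝ) ^ s / Mharm k ^ j := fun j =>
    Finset.sum_nonneg fun k _ => by
      have := one_le_mharm k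
      positivity
  have hS0 : 0 ≤ S := hnn r
  have hT0 : 0 ≤ T := hnn (r + 1)
  have hr : (0 : ℝ) ≤ r := Nat.cast_nonneg r
  have h1 : r / ((s : ℝ) + 1) * T ≤ r * T :=
    mul_le_mul_of_nonneg_right
      (div_le_self hr (by linarith [(Nat.cast_nonneg s : (0 : ℝ) ≤ s)])) hT0
  have h2 : r * T ≤ r * (1 / (2 * ((r : ℝ) + 1)) * S + |B|) :=
    mul_le_mul_of_nonneg_left ((hB n).trans (by gcongr; exact le_abs_self B)) hr
  have h3 : r * (1 / (2 * ((r : ℝ) + 1)) * S) ≤ S / 2 := by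
    have : r * (1 / (2 * ((r : ℝ) + 1))) ≤ 1 / 2 := by
      rw [mul_one_div, div_le_div_iff₀ (by positivity) (by norm_num)]
      linarith
    nlinarith
  rw [Real.norm_of_nonneg hS0, one_mul]
  refine le_trans ?_ (le_abs_self _)
  linarith

lemma sum_sub_expansion_isBigO (s d r : ℕ) :
    (fun n : ℕ => ∑ k ∈ Finset.Icc 2 n, (k : ℝ) ^ s / Mharm k ^ r
        - ∑ j ∈ Finset.range d, ((∏ i ∈ Finset.range j, ((r : ℝ) + i)) / ((s : ℝ) + 1) ^ (j + 1)) *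
          (n : ℝ) ^ (s + 1) / Mharm n ^ (r + j))
      =O[atTop] fun n : ℕ => (n : ℝ) ^ (s + 1) / Mharm n ^ (r + d) := by
  induction d generalizing r with
  | zero => simpa using sum_isBigO r s
  | succ d ih =>
    have h := (ih (r + 1)).const_mul_left (r / ((s : ℝ) + 1))
    rw [show r + 1 + d = r + (d + 1) by ring] at h
    refine ((sum_sub_isBigO r s (r + (d + 1))).add h).congr_left fun n => ?_
    have hs : (s : ℝ) + 1 ≠ 0 := by positivity
    have e : ∑ j ∈ Finset.range (d + 1),
          ((∏ i ∈ Finset.range j, ((r : ℝ) + i)) / ((s : ℝ) + 1) ^ (j + 1)) *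
            (n : ℝ) ^ (s + 1) / Mharm n ^ (r + j)
        = r / ((s : ℝ) + 1) * ∑ j ∈ Finset.range d,
          ((∏ i ∈ Finset.range j, (((r + 1 : ℕ) : ℝ) + i)) / ((s : ℝ) + 1) ^ (j + 1)) *
            (n : ℝ) ^ (s + 1) / Mharm n ^ (r + 1 + j)
          + (n : ℝ) ^ (s + 1) / ((s + 1) * Mharm n ^ r) := by
      rw [Finset.sum_range_succ', Finset.mul_sum]
      congr 1
      · refine Finset.sum_congr rfl fun j _ => ?_
        rw [Finset.prod_range_succ', show r + (j + 1) = r + 1 + j by ring,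
          Finset.prod_congr rfl fun i _ =>
            show (r : ℝ) + (i + 1 : ℕ) = ((r + 1 : ℕ) : ℝ) + i by push_cast; ring]
        have := one_le_mharm n
        field_simp
        ring
      · have := one_le_mharm n
        simp
        field_simp
    rw [e]
    ring

theorem wunderlich_lemma_sum_asymptotic (r s t : ℕ) (hrt : r ≤ t) :
    (fun n : ℕ =>
        (∑ k ∈ Finset.Icc 2 n, (k : ℝ) ^ s / (Mharm k) ^ r) -
          ((n : ℝ) ^ (s + 1) / ((s + 1) * (Mharm n) ^ r) +
            ∑ j ∈ Finset.Icc 1 (t - r - 1),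
              ((∏ i ∈ Finset.range j, ((r : ℝ) + i)) / ((s : ℝ) + 1) ^ (j + 1)) *
                (n : ℝ) ^ (s + 1) / (Mharm n) ^ (r + j)))
      =O[atTop] fun n : ℕ => (n : ℝ) ^ (s + 1) / (Mharm n) ^ t := by
  obtain ⟨d, rfl⟩ := Nat.exists_eq_add_of_le hrt
  cases d with
  | zero =>
    have hlead := (isBigO_refl (fun n : ℕ => (n : ℝ) ^ (s + 1) / Mharm n ^ r) atTop).const_mul_left
      ((s : ℝ) + 1)⁻¹
    refine ((sum_isBigO r s).sub hlead).congr_left fun n => ?_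
    simp only [div_eq_mul_inv, mul_inv, add_zero, Nat.sub_self, Nat.zero_sub,
      Finset.Icc_eq_empty_of_lt zero_lt_one, Finset.sum_empty]
    ring
  | succ d =>
    refine (sum_sub_expansion_isBigO s (d + 1) r).congr_left fun n => ?_
    rw [show r + (d + 1) - r - 1 = d by omega, ← Finset.Ico_add_one_right_eq_Icc 1 d,
      Finset.sum_Ico_eq_sum_range, Finset.sum_range_succ', add_comm, Nat.add_sub_cancel]
    have := one_le_mharm n
    simp only [add_comm 1]
    congr 2
    simp
    field_simp
end
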